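/- Let M be a positive integer and f : ℤ → ℂ an M-periodic function which is either even or odd. Define Q_{f,M} := { α ∈ ℚ : mean(f_{α/M}) = 0 and mean((U_M f)_{α/M}) = 0 }. Then for every α ∈ ℚ*: α ∈ Q_{f,M} if and only if -1/α ∈ Q_{f,M}. -/

import Mathlib

open Complex

/-- The discrete Fourier transform `U_M f` of an `M`-periodic function `f : ℤ → ℂ`. -/
noncomputable def dft (M : ℕ) (f : ℤ → ℂ) (n : ℤ) : ℂ :=
  (Real.sqrt M : ℂ)⁻¹ * ∑ ℓ ∈ Finset.range M, f ℓ *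
    Complex.exp (-2 * Real.pi * Complex.I * ℓ * n / M)

/-- The mean value of the twisted function `g_β(n) = g(n) e^{iπn²β}` of an `M`-periodic `g`,
computed over the period `lcm(M, 2·den β)`. -/
noncomputable def meanTwist (M : ℕ) (g : ℤ → ℂ) (β : ℚ) : ℂ :=
  ((Nat.lcm M (2 * β.den) : ℕ) : ℂ)⁻¹ *
    ∑ n ∈ Finset.range (Nat.lcm M (2 * β.den)),
      g n * Complex.exp (Real.pi * Complex.I * (n : ℂ) ^ 2 * (β : ℂ))

section QuasiPeriodic

/-- Functions on `ZMod N` which are `M`-periodic and become `p`-periodic after multiplication by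
the Gaussian `k ↦ ψ (q² k²)`. -/
structure GaussQuasiPeriodic {N : ℕ} (ψ : AddChar (ZMod N) ℂ) (p q M : ℤ)
    (v : ZMod N → ℂ) : Prop where
  add_mul_period : ∀ k b, v (k + M * b) = v k
  add_mul_quasi : ∀ k a, v (k + p * a) * ψ (q ^ 2 * (k + p * a) ^ 2) = v k * ψ (q ^ 2 * k ^ 2)

variable {N : ℕ} {ψ : AddChar (ZMod N) ℂ} {p q M : ℤ} {v w : ZMod N → ℂ}

namespace GaussQuasiPeriodic

/-- At a point of the support, the two period laws are compatible along common multiples. -/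
lemma gauss_eq_of_ne_zero (hψ : Function.Injective ψ) (hv : GaussQuasiPeriodic ψ p q M v)
    {a b : ℤ} (hab : p * a = M * b) {k : ZMod N} (hk : v k ≠ 0) :
    (q ^ 2 * (2 * k * (p * a) + (p * a) ^ 2) : ZMod N) = 0 := by
  have hab' : (p * a : ZMod N) = M * b := by exact_mod_cast congrArg (Int.cast : ℤ → ZMod N) hab
  have h1 := hv.add_mul_quasi k a
  have h2 := hv.add_mul_period k b
  rw [← hab'] at h2
  rw [h2] at h1
  have h3 := hψ (mul_left_cancel₀ hk h1)
  linear_combination h3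

/-- The quasi-periodic functions form a space of dimension at most one. -/
lemma mul_comm_apply (hψ : Function.Injective ψ)
    (hN : ∀ z : ℤ, (z : ZMod N) = 0 ↔ 2 * p * q * M ∣ z)
    (hp : p ≠ 0) (hq : q ≠ 0) (hM : M ≠ 0) (hpq : IsCoprime p q)
    (hv : GaussQuasiPeriodic ψ p q M v) (hw : GaussQuasiPeriodic ψ p q M w) (k l : ZMod N) :
    v k * w l = v l * w k := by
  obtain ⟨K, rfl⟩ := ZMod.intCast_surjective k
  obtain ⟨L, rfl⟩ := ZMod.intCast_surjective l
  obtain ⟨a, ha⟩ : (Int.gcd p M : ℤ) ∣ M := Int.gcd_dvd_right ..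
  obtain ⟨b, hb⟩ : (Int.gcd p M : ℤ) ∣ p := Int.gcd_dvd_left ..
  have hab : p * a = M * b := by
    calc p * a = (Int.gcd p M * b) * a := by rw [← hb]
      _ = (Int.gcd p M * a) * b := by ring
      _ = M * b := by rw [← ha]
  have ha0 : a ≠ 0 := by
    rintro rfl
    exact hM (by simpa using ha)
  have transport : (Int.gcd p M : ℤ) ∣ L - K →
      v (K : ZMod N) * w (L : ZMod N) = v (L : ZMod N) * w (K : ZMod N) := by
    rintro ⟨c, hc⟩
    have hbez := Int.gcd_eq_gcd_ab p M
    set s := Int.gcdA p M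
    set t := Int.gcdB p M
    have hL : (L : ZMod N) = (K + p * (s * c : ℤ)) + M * (t * c : ℤ) := by
      have : L = (K + p * (s * c)) + M * (t * c) := by
        linear_combination hc + c * hbez
      exact_mod_cast congrArg (Int.cast : ℤ → ZMod N) this
    rw [hL, hv.add_mul_period, hw.add_mul_period]
    have h1 := hv.add_mul_quasi K (s * c : ℤ)
    have h2 := hw.add_mul_quasi K (s * c : ℤ)
    set e := ψ (q ^ 2 * (K + p * (s * c : ℤ)) ^ 2)
    have he : e ≠ 0 := (ψ.val_isUnit _).ne_zero
    apply mul_right_cancel₀ he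
    linear_combination v (K : ZMod N) * h2 - w (K : ZMod N) * h1
  by_cases hdvd : (Int.gcd p M : ℤ) ∣ L - K
  · exact transport hdvd
  · have key : ¬ ((v (K : ZMod N) ≠ 0 ∨ w (K : ZMod N) ≠ 0) ∧
        (v (L : ZMod N) ≠ 0 ∨ w (L : ZMod N) ≠ 0)) := by
      rintro ⟨hK, hL⟩
      have hK' := hK.elim (hv.gauss_eq_of_ne_zero hψ hab) (hw.gauss_eq_of_ne_zero hψ hab)
      have hL' := hL.elim (hv.gauss_eq_of_ne_zero hψ hab) (hw.gauss_eq_of_ne_zero hψ hab)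
      have h : ((2 * q ^ 2 * (p * a) * (L - K) : ℤ) : ZMod N) = 0 := by
        push_cast
        linear_combination hL' - hK'
      rw [hN] at h
      have h1 : (2 * p * q * a) * (Int.gcd p M : ℤ) ∣ (2 * p * q * a) * (q * (L - K)) := by
        convert h using 1
        · linear_combination -(2 * p * q) * ha
        · ring
      have h2 := Int.dvd_of_mul_dvd_mul_left (by positivity) h1
      have hcop : IsCoprime (Int.gcd p M : ℤ) q :=
        hpq.of_isCoprime_of_dvd_left (Int.gcd_dvd_left ..)
      exact hdvd (hcop.dvd_of_dvd_mul_left h2)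
    have h0 : (v (K : ZMod N) = 0 ∧ w (K : ZMod N) = 0) ∨
        (v (L : ZMod N) = 0 ∧ w (L : ZMod N) = 0) := by tauto
    rcases h0 with ⟨h1, h2⟩ | ⟨h1, h2⟩ <;> simp only [h1, h2, zero_mul, mul_zero]

/-- If `p q M` is odd, only the zero function is quasi-periodic. -/
lemma eq_zero_of_odd (hψ : Function.Injective ψ)
    (hN : ∀ z : ℤ, (z : ZMod N) = 0 ↔ 2 * p * q * M ∣ z)
    (hp : p ≠ 0) (hq : q ≠ 0) (hM : M ≠ 0) (hodd : ¬ 2 ∣ p * q * M)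
    (hv : GaussQuasiPeriodic ψ p q M v) (k : ZMod N) : v k = 0 := by
  by_contra hk
  obtain ⟨K, rfl⟩ := ZMod.intCast_surjective k
  have h := hv.gauss_eq_of_ne_zero hψ (mul_comm p M) hk
  have h' : ((q ^ 2 * (2 * K * (p * M) + (p * M) ^ 2) : ℤ) : ZMod N) = 0 := by
    push_cast
    exact h
  rw [hN] at h'
  have h1 : (p * q * M) * 2 ∣ (p * q * M) * (p * q * M) := by
    obtain ⟨c, hc⟩ := h'
    exact ⟨c - q * K, by linear_combination hc⟩
  exact hodd (Int.dvd_of_mul_dvd_mul_left (by positivity) h1)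

end GaussQuasiPeriodic

lemma cast_two_mul_eq_zero (hN : ∀ z : ℤ, (z : ZMod N) = 0 ↔ 2 * p * q * M ∣ z) :
    (2 * p * q * M : ZMod N) = 0 := by
  have := (hN (2 * p * q * M)).2 dvd_rfl
  exact_mod_cast this

lemma sq_eq_zero_of_even (hN : ∀ z : ℤ, (z : ZMod N) = 0 ↔ 2 * p * q * M ∣ z)
    (heven : 2 ∣ p * q * M) (i : ZMod N) : ((p * q * M * i) ^ 2 : ZMod N) = 0 := by
  obtain ⟨c, hc⟩ := heven
  have hc' : (p * q * M : ZMod N) = 2 * c := by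
    exact_mod_cast congrArg (Int.cast : ℤ → ZMod N) hc
  linear_combination (p * q * M * i ^ 2) * hc' + (c * i ^ 2) * cast_two_mul_eq_zero hN

end QuasiPeriodic

section GaussSums

variable {N : ℕ} [NeZero N] {ψ : AddChar (ZMod N) ℂ} {p q M : ℤ}

lemma AddChar.isPrimitive_of_injective {N : ℕ} {ψ : AddChar (ZMod N) ℂ}
    (hψ : Function.Injective ψ) : ψ.IsPrimitive := by
  intro a ha h
  apply ha
  apply hψ
  have := DFunLike.congr_fun h 1
  simpa [AddChar.mulShift_apply] using this

/-- The Fourier transform of the Gaussian `n ↦ ψ (p² n²)`. -/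
noncomputable def gaussTransform (ψ : AddChar (ZMod N) ℂ) (p q : ℤ) (k : ZMod N) : ℂ :=
  ∑ n, ψ (p ^ 2 * n ^ 2 + 2 * p * q * k * n)

/-- The `M`-periodization of the Gaussian `n ↦ ψ (-q² n²)`. -/
noncomputable def gaussPeriodization (ψ : AddChar (ZMod N) ℂ) (q M : ℤ) (k : ZMod N) : ℂ :=
  ∑ j, ψ (-(q ^ 2 * (k + M * j) ^ 2))

lemma gaussTransform_quasiPeriodic (hN : ∀ z : ℤ, (z : ZMod N) = 0 ↔ 2 * p * q * M ∣ z) :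
    GaussQuasiPeriodic ψ p q M (gaussTransform ψ p q) where
  add_mul_period k b := by
    refine Finset.sum_congr rfl fun n _ => ?_
    congr 1
    linear_combination (b * n) * cast_two_mul_eq_zero hN
  add_mul_quasi k a := by
    simp only [gaussTransform, Finset.sum_mul, ← AddChar.map_add_eq_mul]
    refine Fintype.sum_equiv (Equiv.addRight (q * a : ZMod N)) _ _ fun n => ?_
    congr 1
    simp only [Equiv.coe_addRight]
    ring

lemma gaussPeriodization_quasiPeriodic
    (hN : ∀ z : ℤ, (z : ZMod N) = 0 ↔ 2 * p * q * M ∣ z) :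
    GaussQuasiPeriodic ψ p q M (gaussPeriodization ψ q M) where
  add_mul_period k b := by
    refine Fintype.sum_equiv (Equiv.addRight b) _ _ fun n => ?_
    congr 1
    simp only [Equiv.coe_addRight]
    ring
  add_mul_quasi k a := by
    simp only [gaussPeriodization, Finset.sum_mul, ← AddChar.map_add_eq_mul]
    refine Finset.sum_congr rfl fun j _ => ?_
    congr 1
    linear_combination (-(q * a * j)) * cast_two_mul_eq_zero hN

/-- A sum of terms equal to `0` or to `c ≠ 0`, with at least one nonzero term, is nonzero. -/
lemma sum_ite_ne_zero {ι : Type*} [Fintype ι] (P : ι → Prop) [DecidablePred P] {c : ℂ}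
    (hc : c ≠ 0) {i : ι} (hi : P i) : ∑ t, (if P t then c else 0) ≠ 0 := by
  rw [Finset.sum_ite, Finset.sum_const, Finset.sum_const_zero, add_zero, nsmul_eq_mul]
  refine mul_ne_zero (Nat.cast_ne_zero.2 ?_) hc
  exact Finset.card_ne_zero_of_mem (Finset.mem_filter.2 ⟨Finset.mem_univ i, hi⟩)

lemma exists_gaussTransform_ne_zero (hψ : Function.Injective ψ)
    (hN : ∀ z : ℤ, (z : ZMod N) = 0 ↔ 2 * p * q * M ∣ z)
    (hp : p ≠ 0) (hq : q ≠ 0) (hM : M ≠ 0) (hpq : IsCoprime p q) (heven : 2 ∣ p * q * M) :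
    ∃ k, gaussTransform ψ p q k ≠ 0 := by
  by_contra! h
  have h0 : ∑ k, ∑ m, gaussTransform ψ p q k * ψ (-(p ^ 2 * m ^ 2 + 2 * p * q * k * m)) = 0 := by
    simp [h]
  have h1 : ∀ k m, gaussTransform ψ p q k * ψ (-(p ^ 2 * m ^ 2 + 2 * p * q * k * m)) =
      ∑ t, ψ (p ^ 2 * t ^ 2) * (ψ (m * (2 * p ^ 2 * t)) * ψ (k * (2 * p * q * t))) := by
    intro k m
    simp only [gaussTransform, Finset.sum_mul, ← AddChar.map_add_eq_mul]
    refine (Fintype.sum_equiv (Equiv.addRight m) _ _ fun n => ?_).symm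
    congr 1
    simp only [Equiv.coe_addRight]
    ring
  have hprim := AddChar.isPrimitive_of_injective hψ
  have h2 : ∑ t : ZMod N, (if (2 * p ^ 2 * t : ZMod N) = 0 ∧ (2 * p * q * t : ZMod N) = 0
      then (N : ℂ) * N else 0) = 0 := by
    refine Eq.trans ?_ h0
    simp only [h1]
    rw [Finset.sum_comm, Finset.sum_congr rfl fun m _ => Finset.sum_comm, Finset.sum_comm]
    refine Finset.sum_congr rfl fun t _ => ?_
    simp_rw [← Finset.mul_sum, ← Finset.sum_mul]
    rw [AddChar.sum_mulShift _ hprim, AddChar.sum_mulShift _ hprim, ZMod.card]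
    by_cases ha : (2 * p ^ 2 * t : ZMod N) = 0 <;> by_cases hb : (2 * p * q * t : ZMod N) = 0 <;>
      simp only [ha, hb, and_true, and_false, if_true, if_false, mul_zero, zero_mul, and_self,
        Nat.cast_zero]
    obtain ⟨T, rfl⟩ := ZMod.intCast_surjective t
    have ha' : ((2 * p ^ 2 * T : ℤ) : ZMod N) = 0 := by exact_mod_cast ha
    have hb' : ((2 * p * q * T : ℤ) : ZMod N) = 0 := by exact_mod_cast hb
    rw [hN] at ha' hb'
    obtain ⟨i, rfl⟩ : M ∣ T := Int.dvd_of_mul_dvd_mul_left (a := 2 * p * q) (by positivity) hb'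
    have hqi : q ∣ p * i := by
      apply Int.dvd_of_mul_dvd_mul_left (a := 2 * p * M) (by positivity)
      convert ha' using 1 <;> ring
    obtain ⟨c, rfl⟩ := hpq.symm.dvd_of_dvd_mul_left hqi
    have : (p ^ 2 * ((M * (q * c) : ℤ) : ZMod N) ^ 2 : ZMod N) = 0 := by
      push_cast
      linear_combination sq_eq_zero_of_even hN heven c
    rw [this]
    simp
  refine sum_ite_ne_zero _ ?_ (i := (0 : ZMod N)) (by simp) h2
  simp [NeZero.ne N]

lemma exists_gaussPeriodization_ne_zero (hψ : Function.Injective ψ)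
    (hN : ∀ z : ℤ, (z : ZMod N) = 0 ↔ 2 * p * q * M ∣ z)
    (hq : q ≠ 0) (hM : M ≠ 0) (hpq : IsCoprime p q) (heven : 2 ∣ p * q * M) :
    ∃ k, gaussPeriodization ψ q M k ≠ 0 := by
  by_contra! h
  have h0 : ∑ k, gaussPeriodization ψ q M k * ψ (q ^ 2 * k ^ 2) = 0 := by simp [h]
  have h1 : ∀ k, gaussPeriodization ψ q M k * ψ (q ^ 2 * k ^ 2) =
      ∑ j, ψ (-(q ^ 2 * M ^ 2 * j ^ 2)) * ψ (k * (-(2 * q ^ 2 * M * j))) := by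
    intro k
    simp only [gaussPeriodization, Finset.sum_mul, ← AddChar.map_add_eq_mul]
    refine Finset.sum_congr rfl fun j _ => ?_
    congr 1
    ring
  have hprim := AddChar.isPrimitive_of_injective hψ
  have h2 : ∑ j : ZMod N, (if (-(2 * q ^ 2 * M * j) : ZMod N) = 0 then (N : ℂ) else 0) = 0 := by
    refine Eq.trans ?_ h0
    simp only [h1]
    rw [Finset.sum_comm]
    refine Finset.sum_congr rfl fun j _ => ?_
    rw [← Finset.mul_sum, AddChar.sum_mulShift _ hprim, ZMod.card]
    split_ifs with ha
    swap
    · simp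
    obtain ⟨J, rfl⟩ := ZMod.intCast_surjective j
    have ha' : ((2 * q ^ 2 * M * J : ℤ) : ZMod N) = 0 := by
      push_cast
      exact neg_eq_zero.1 ha
    rw [hN] at ha'
    have hqi : p ∣ q * J := by
      apply Int.dvd_of_mul_dvd_mul_left (a := 2 * q * M) (by positivity)
      convert ha' using 1 <;> ring
    obtain ⟨c, rfl⟩ := hpq.dvd_of_dvd_mul_left hqi
    have : (-(q ^ 2 * M ^ 2 * ((p * c : ℤ) : ZMod N) ^ 2) : ZMod N) = 0 := by
      push_cast
      linear_combination -sq_eq_zero_of_even hN heven c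
    rw [this]
    simp
  exact sum_ite_ne_zero _ (by simp [NeZero.ne N]) (i := (0 : ZMod N)) (by simp) h2

/-- Qualitative Gauss reciprocity: the two Gaussian kernels annihilate the same functions. -/
lemma sum_gaussTransform_eq_zero_iff (hψ : Function.Injective ψ)
    (hN : ∀ z : ℤ, (z : ZMod N) = 0 ↔ 2 * p * q * M ∣ z)
    (hp : p ≠ 0) (hq : q ≠ 0) (hM : M ≠ 0) (hpq : IsCoprime p q) (F : ZMod N → ℂ) :
    ∑ k, F k * gaussTransform ψ p q k = 0 ↔ ∑ k, F k * gaussPeriodization ψ q M k = 0 := by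
  have hv := gaussTransform_quasiPeriodic (ψ := ψ) hN
  have hw := gaussPeriodization_quasiPeriodic (ψ := ψ) hN
  by_cases heven : 2 ∣ p * q * M
  · obtain ⟨k, hk⟩ := exists_gaussTransform_ne_zero hψ hN hp hq hM hpq heven
    obtain ⟨l, hl⟩ := exists_gaussPeriodization_ne_zero hψ hN hq hM hpq heven
    have hcomm := hv.mul_comm_apply hψ hN hp hq hM hpq hw
    have hl' : gaussTransform ψ p q l ≠ 0 := fun h => by
      have := hcomm k l
      simp_all
    have key : (∑ k, F k * gaussTransform ψ p q k) * gaussPeriodization ψ q M l =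
        gaussTransform ψ p q l * ∑ k, F k * gaussPeriodization ψ q M k := by
      rw [Finset.sum_mul, Finset.mul_sum]
      refine Finset.sum_congr rfl fun j _ => ?_
      linear_combination F j * hcomm j l
    constructor <;> intro h <;> simp_all
  · simp [hv.eq_zero_of_odd hψ hN hp hq hM heven, hw.eq_zero_of_odd hψ hN hp hq hM heven]

/-- Vanishing of a Gaussian sum of `G` is equivalent to vanishing of the inverted Gaussian sum of
the Fourier transform of `G`. -/
lemma sum_gauss_eq_zero_iff (hψ : Function.Injective ψ)
    (hN : ∀ z : ℤ, (z : ZMod N) = 0 ↔ 2 * p * q * M ∣ z)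
    (hp : p ≠ 0) (hq : q ≠ 0) (hM : M ≠ 0) (hpq : IsCoprime p q) (G : ZMod N → ℂ)
    (hG : ∀ x t : ZMod N, 2 * p * q * t = 0 → G (x + t) = G x) :
    ∑ n, G n * ψ (p ^ 2 * n ^ 2) = 0 ↔
      ∑ k, (∑ x, G x * ψ (-(2 * p * q * k * x))) * ψ (-(q ^ 2 * k ^ 2)) = 0 := by
  have hprim := AddChar.isPrimitive_of_injective hψ
  set F : ZMod N → ℂ := fun k => ∑ x, G x * ψ (-(2 * p * q * k * x)) with hF
  have hN0 : (N : ℂ) ≠ 0 := by simp [NeZero.ne N]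
  have hFper : ∀ k j, F (k + M * j) = F k := by
    intro k j
    refine Finset.sum_congr rfl fun x _ => ?_
    congr 2
    linear_combination (-(j * x)) * cast_two_mul_eq_zero hN
  have h1 : ∑ k, F k * gaussPeriodization ψ q M k = N * ∑ k, F k * ψ (-(q ^ 2 * k ^ 2)) := by
    simp only [gaussPeriodization, Finset.mul_sum]
    rw [Finset.sum_comm]
    have : ∀ j : ZMod N, ∑ k, F k * ψ (-(q ^ 2 * (k + M * j) ^ 2)) =
        ∑ k, F k * ψ (-(q ^ 2 * k ^ 2)) := by
      intro j
      refine Fintype.sum_equiv (Equiv.addRight (M * j : ZMod N)) _ _ fun k => ?_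
      simp only [Equiv.coe_addRight, hFper]
    simp only [this, Finset.sum_const, Finset.card_univ, ZMod.card, nsmul_eq_mul, Finset.mul_sum]
  have h2 : ∑ k, F k * gaussTransform ψ p q k =
      (∑ t : ZMod N, if (-(2 * p * q * t) : ZMod N) = 0 then (N : ℂ) else 0) *
        ∑ n, G n * ψ (p ^ 2 * n ^ 2) := by
    have expand : ∀ k, F k * gaussTransform ψ p q k = ∑ n, ∑ t,
        G (n + t) * ψ (p ^ 2 * n ^ 2) * ψ (k * -(2 * p * q * t)) := by
      intro k
      rw [gaussTransform, Finset.mul_sum]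
      refine Finset.sum_congr rfl fun n _ => ?_
      rw [hF, Finset.sum_mul]
      refine (Fintype.sum_equiv (Equiv.addLeft n) _ _ fun t => ?_).symm
      simp only [Equiv.coe_addLeft, mul_assoc, ← AddChar.map_add_eq_mul]
      congr 2
      ring
    simp only [expand]
    rw [Finset.sum_comm, Finset.mul_sum]
    refine Finset.sum_congr rfl fun n _ => ?_
    rw [Finset.sum_comm, Finset.sum_mul]
    refine Finset.sum_congr rfl fun t _ => ?_
    rw [← Finset.mul_sum, AddChar.sum_mulShift _ hprim, ZMod.card]
    split_ifs with ht
    · rw [hG n t (neg_eq_zero.1 ht)]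
      ring
    · simp
  have h3 := sum_gaussTransform_eq_zero_iff hψ hN hp hq hM hpq F
  rw [h1, h2, mul_eq_zero, mul_eq_zero, or_iff_right hN0,
    or_iff_right (sum_ite_ne_zero _ hN0 (i := (0 : ZMod N)) (by simp))] at h3
  exact h3

end GaussSums

section MeanTwist

lemma exists_injective_addChar {N : ℕ} [NeZero N] {D : ℤ} (hD : N = D.natAbs) :
    ∃ ψ : AddChar (ZMod N) ℂ, Function.Injective ψ ∧
      ∀ z : ℤ, ψ z = exp (2 * Real.pi * I * z / D) := by
  rcases Int.natAbs_eq D with h | h <;> rw [← hD] at h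
  · refine ⟨ZMod.stdAddChar, ZMod.injective_stdAddChar, fun z => ?_⟩
    rw [ZMod.stdAddChar_coe, h]
    push_cast
    rfl
  · refine ⟨ZMod.stdAddChar⁻¹, fun x y hxy => ?_, fun z => ?_⟩
    · rw [AddChar.inv_apply, AddChar.inv_apply] at hxy
      exact neg_injective (ZMod.injective_stdAddChar hxy)
    · rw [AddChar.inv_apply, ← Int.cast_neg, ZMod.stdAddChar_coe, h]
      push_cast
      congr 1
      rw [mul_neg, neg_div, div_neg]

lemma sum_range_mul_of_periodic {φ : ℤ → ℂ} {P : ℕ} (hφ : Function.Periodic φ (P : ℤ)) (k : ℕ) :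
    ∑ n ∈ Finset.range (P * k), φ n = k * ∑ n ∈ Finset.range P, φ n := by
  induction k with
  | zero => simp
  | succ k ih =>
    rw [mul_add_one, Finset.sum_range_add, ih]
    have : ∀ n : ℕ, φ ((P * k + n : ℕ) : ℤ) = φ n := fun n => by
      have := hφ.int_mul k n
      rw [← this]
      congr 1
      push_cast
      ring
    simp only [this]
    push_cast
    ring

lemma sum_range_eq_sum_zmod (φ : ℤ → ℂ) (N : ℕ) [NeZero N] :
    ∑ n ∈ Finset.range N, φ n = ∑ x : ZMod N, φ x.val := by
  obtain ⟨n, rfl⟩ := Nat.exists_eq_succ_of_ne_zero (NeZero.ne N)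
  exact Finset.sum_range _

lemma periodic_twist {g : ℤ → ℂ} {P : ℕ} (hg : Function.Periodic g (P : ℤ)) (β : ℚ)
    (hP : 2 * β.den ∣ P) :
    Function.Periodic (fun n : ℤ => g n * exp (Real.pi * I * (n : ℂ) ^ 2 * (β : ℂ))) (P : ℤ) := by
  intro n
  obtain ⟨c, rfl⟩ := hP
  have hden : (β.den : ℂ) ≠ 0 := by exact_mod_cast β.den_nz
  simp only [hg n]
  congr 1
  rw [exp_eq_exp_iff_exists_int]
  refine ⟨2 * n * c * β.num + 2 * β.den * c ^ 2 * β.num, ?_⟩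
  rw [Rat.cast_def]
  push_cast
  field_simp
  ring

/-- The mean may be computed over any common period `N`. -/
lemma meanTwist_eq_zero_iff {M N : ℕ} {g : ℤ → ℂ} (hg : Function.Periodic g (M : ℤ)) (β : ℚ)
    (hN : N ≠ 0) (hMN : M ∣ N) (hβ : 2 * β.den ∣ N) :
    meanTwist M g β = 0 ↔
      ∑ n ∈ Finset.range N, g n * exp (Real.pi * I * (n : ℂ) ^ 2 * (β : ℂ)) = 0 := by
  obtain ⟨k, rfl⟩ := Nat.lcm_dvd hMN hβ
  have hL : Nat.lcm M (2 * β.den) ≠ 0 := left_ne_zero_of_mul hN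
  have hk : k ≠ 0 := right_ne_zero_of_mul hN
  have hgL : Function.Periodic g (Nat.lcm M (2 * β.den) : ℕ) := by
    obtain ⟨c, hc⟩ := Nat.dvd_lcm_left M (2 * β.den)
    rw [hc, mul_comm]
    exact_mod_cast hg.int_mul c
  have h := sum_range_mul_of_periodic (periodic_twist hgL β (Nat.dvd_lcm_right ..)) k
  simp only [Int.cast_natCast] at h
  rw [h, meanTwist, mul_eq_zero, mul_eq_zero, or_iff_right, or_iff_right]
  · exact_mod_cast hk
  · exact inv_ne_zero (by exact_mod_cast hL)

lemma periodic_expKernel {M : ℕ} (hM : M ≠ 0) (n : ℤ) :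
    Function.Periodic (fun l : ℤ => exp (-2 * Real.pi * I * l * n / M)) (M : ℤ) := by
  intro l
  have hM' : (M : ℂ) ≠ 0 := by exact_mod_cast hM
  rw [exp_eq_exp_iff_exists_int]
  refine ⟨-n, ?_⟩
  push_cast
  field_simp
  ring

lemma dft_periodic {M : ℕ} (hM : M ≠ 0) (f : ℤ → ℂ) : Function.Periodic (dft M f) (M : ℤ) := by
  intro n
  simp only [dft]
  congr 1
  refine Finset.sum_congr rfl fun l _ => ?_
  congr 1
  have := periodic_expKernel hM l n
  simp only [Int.cast_natCast] at this
  convert this using 2 <;> ring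

/-- The twisted mean of `f` at `α / M` vanishes exactly when that of its discrete Fourier
transform at `-1 / (α M)` does. -/
lemma meanTwist_eq_zero_iff_dft {M : ℕ} (hM : M ≠ 0) {f : ℤ → ℂ}
    (hf : Function.Periodic f (M : ℤ)) {α : ℚ} (hα : α ≠ 0) :
    meanTwist M f (α / M) = 0 ↔ meanTwist M (dft M f) ((-1 / α) / M) = 0 := by
  obtain ⟨p, hp_def⟩ : ∃ p : ℤ, p = α.num := ⟨_, rfl⟩
  obtain ⟨q, hq_def⟩ : ∃ q : ℕ, q = α.den := ⟨_, rfl⟩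
  have hp : p ≠ 0 := hp_def ▸ Rat.num_ne_zero.2 hα
  have hq : q ≠ 0 := hq_def ▸ α.den_nz
  have hpq : IsCoprime p (q : ℤ) := by
    rw [hp_def, hq_def]
    exact Rat.isCoprime_num_den α
  have hα_eq : α = p / q := by rw [hp_def, hq_def, Rat.num_div_den]
  clear hp_def hq_def
  subst hα_eq
  have hpC : (p : ℂ) ≠ 0 := by exact_mod_cast hp
  have hqC : (q : ℂ) ≠ 0 := by exact_mod_cast hq
  have hMC : (M : ℂ) ≠ 0 := by exact_mod_cast hM
  obtain ⟨D, hD⟩ : ∃ D : ℤ, D = 2 * p * q * M := ⟨_, rfl⟩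
  obtain ⟨N, hND⟩ : ∃ N : ℕ, N = D.natAbs := ⟨_, rfl⟩
  have hN0 : N ≠ 0 := by
    rw [hND, hD, Int.natAbs_ne_zero]
    positivity
  have : NeZero N := ⟨hN0⟩
  have hN : ∀ z : ℤ, (z : ZMod N) = 0 ↔ 2 * p * (q : ℤ) * (M : ℤ) ∣ z := by
    intro z
    rw [ZMod.intCast_zmod_eq_zero_iff_dvd, hND, Int.natAbs_dvd, hD]
  have hMN : M ∣ N := by
    rw [hND, hD, ← Int.natCast_dvd]
    exact dvd_mul_left ..
  have hβ₁ : 2 * ((p / q : ℚ) / M).den ∣ N := by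
    rw [hND, hD, ← Int.natCast_dvd]
    have h := Rat.den_dvd p (q * M)
    have e : (p / q : ℚ) / M = Rat.divInt p (q * M) := by
      rw [Rat.divInt_eq_div]
      push_cast
      rw [div_div]
    rw [e]
    push_cast
    obtain ⟨c, hc⟩ := h
    exact ⟨p * c, by linear_combination (2 * p) * hc⟩
  have hβ₂ : 2 * ((-1 / (p / q : ℚ)) / M).den ∣ N := by
    rw [hND, hD, ← Int.natCast_dvd]
    have h := Rat.den_dvd (-q) (p * M)
    have e : (-1 / (p / q : ℚ)) / M = Rat.divInt (-q) (p * M) := by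
      rw [Rat.divInt_eq_div]
      push_cast
      field_simp
    rw [e]
    push_cast
    obtain ⟨c, hc⟩ := h
    exact ⟨q * c, by linear_combination (2 * (q : ℤ)) * hc⟩
  obtain ⟨ψ, hψ, hψz⟩ := exists_injective_addChar hND
  have hval : ∀ x : ZMod N, (((x.val : ℤ)) : ZMod N) = x := fun x => by simp
  have hG : ∀ x t : ZMod N, 2 * (p : ZMod N) * ((q : ℤ) : ZMod N) * t = 0 →
      f (x + t).val = f x.val := by
    intro x t ht
    have h : ((2 * p * q * ((x + t).val - x.val : ℤ) : ℤ) : ZMod N) = 0 := by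
      push_cast at ht ⊢
      simp only [ZMod.natCast_val, ZMod.cast_id', id_eq]
      linear_combination ht
    rw [hN] at h
    obtain ⟨c, hc⟩ := Int.dvd_of_mul_dvd_mul_left (by positivity) h
    rw [sub_eq_iff_eq_add'] at hc
    rw [hc, mul_comm]
    exact hf.int_mul c _
  have hmain := sum_gauss_eq_zero_iff hψ hN hp (by exact_mod_cast hq) (by exact_mod_cast hM) hpq
    (fun x => f x.val) hG
  have hgauss₁ : ∀ x : ZMod N, ψ ((p : ZMod N) ^ 2 * x ^ 2) =
      exp (Real.pi * I * (x.val : ℂ) ^ 2 * (((p / q : ℚ) / M : ℚ) : ℂ)) := by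
    intro x
    have h := hψz (p ^ 2 * (x.val : ℤ) ^ 2)
    rw [Int.cast_mul, Int.cast_pow, Int.cast_pow, hval] at h
    rw [h, hD]
    congr 1
    push_cast
    field_simp
  have hgauss₂ : ∀ x : ZMod N, ψ (-(((q : ℤ) : ZMod N) ^ 2 * x ^ 2)) =
      exp (Real.pi * I * (x.val : ℂ) ^ 2 * (((-1 / (p / q : ℚ)) / M : ℚ) : ℂ)) := by
    intro x
    have h := hψz (-((q : ℤ) ^ 2 * (x.val : ℤ) ^ 2))
    rw [Int.cast_neg, Int.cast_mul, Int.cast_pow, Int.cast_pow, hval] at h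
    rw [h, hD]
    congr 1
    push_cast
    field_simp
  have hlin : ∀ k x : ZMod N, ψ (-(2 * (p : ZMod N) * ((q : ℤ) : ZMod N) * k * x)) =
      exp (-2 * Real.pi * I * (x.val : ℂ) * (k.val : ℂ) / M) := by
    intro k x
    have h := hψz (-(2 * p * (q : ℤ) * (k.val : ℤ) * (x.val : ℤ)))
    simp only [Int.cast_neg, Int.cast_mul, hval, Int.cast_ofNat] at h
    rw [h, hD]
    congr 1
    push_cast
    field_simp
  obtain ⟨m, hm⟩ := hMN
  have hm0 : (m : ℂ) ≠ 0 := by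
    rintro h
    rw [Nat.cast_eq_zero] at h
    exact hN0 (by rw [hm, h, mul_zero])
  have hsqrt : (Real.sqrt M : ℂ) ≠ 0 := by
    rw [ofReal_ne_zero]
    positivity
  have hdft : ∀ k : ZMod N, ∑ x : ZMod N, f x.val *
      ψ (-(2 * (p : ZMod N) * ((q : ℤ) : ZMod N) * k * x)) =
      (m * Real.sqrt M) * dft M f k.val := by
    intro k
    have hper : Function.Periodic
        (fun l : ℤ => f l * exp (-2 * Real.pi * I * l * (k.val : ℤ) / M)) (M : ℤ) :=
      hf.mul (periodic_expKernel hM k.val)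
    have h := sum_range_mul_of_periodic hper m
    rw [← hm, sum_range_eq_sum_zmod
      (fun l : ℤ => f l * exp (-2 * Real.pi * I * l * (k.val : ℤ) / M)) N] at h
    simp only [Int.cast_natCast] at h
    simp only [hlin]
    rw [h]
    simp only [dft, Int.cast_natCast]
    rw [mul_assoc (m : ℂ), mul_inv_cancel_left₀ hsqrt]
  rw [meanTwist_eq_zero_iff hf _ hN0 ⟨m, hm⟩ hβ₁,
    meanTwist_eq_zero_iff (dft_periodic hM f) _ hN0 ⟨m, hm⟩ hβ₂]
  have s₁ := sum_range_eq_sum_zmod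
    (fun n : ℤ => f n * exp (Real.pi * I * (n : ℂ) ^ 2 * (((p / q : ℚ) / M : ℚ) : ℂ))) N
  have s₂ := sum_range_eq_sum_zmod (fun n : ℤ => dft M f n *
    exp (Real.pi * I * (n : ℂ) ^ 2 * (((-1 / (p / q : ℚ)) / M : ℚ) : ℂ))) N
  simp only [Int.cast_natCast] at s₁ s₂
  rw [s₁, s₂]
  simp only [hdft, hgauss₁, hgauss₂] at hmain
  simp only [mul_assoc, ← Finset.mul_sum] at hmain
  simp only [mul_eq_zero, hm0, hsqrt, false_or] at hmain
  simpa only [mul_assoc] using hmain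

end MeanTwist

/-- For an even or odd `M`-periodic `f`, the set
`Q_{f,M} = {α ∈ ℚ : mean(f_{α/M}) = 0 and mean((U_M f)_{α/M}) = 0}` is stable under the
negative inversion: for `α ∈ ℚ*`, `α ∈ Q_{f,M} ↔ -1/α ∈ Q_{f,M}`. -/
theorem statement12 (M : ℕ) (hM : 0 < M) (f : ℤ → ℂ)
    (hf : ∀ n : ℤ, f (n + M) = f n)
    (hpar : (∀ n : ℤ, f (-n) = f n) ∨ (∀ n : ℤ, f (-n) = -f n))
    (α : ℚ) (hα : α ≠ 0) :
    (meanTwist M f (α / M) = 0 ∧ meanTwist M (dft M f) (α / M) = 0) ↔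
    (meanTwist M f ((-1 / α) / M) = 0 ∧ meanTwist M (dft M f) ((-1 / α) / M) = 0) := by
  have hf' : Function.Periodic f (M : ℤ) := hf
  have h₁ := meanTwist_eq_zero_iff_dft hM.ne' hf' hα
  have h₂ := meanTwist_eq_zero_iff_dft hM.ne' hf'
    (div_ne_zero (neg_ne_zero.2 one_ne_zero) hα : -1 / α ≠ 0)
  rw [show -1 / (-1 / α) = α by field_simp] at h₂
  rw [h₁, h₂, and_comm]
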